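/- Let g be a Lie algebra over ℂ, m a Lie subalgebra of g, and χ : g → ℂ a linear form. Let M be a g-module such that for every y ∈ m the operator y − χ(y) (i.e. v ↦ y.v − χ(y)v) acts locally nilpotently on M, and let X be a g-module on which every element of m acts locally nilpotently. Then for every y ∈ m the operator y − χ(y) acts locally nilpotently on the tensor product g-modules M ⊗ X and X ⊗ M. Consequently, the category of such modules M (Whittaker modules) is stable under tensoring on either side by modules on which m acts locally nilpotently, and is a bimodule category over the monoidal category of such modules. -/

import Mathlib

open scoped TensorProduct

theorem tensor_pow_aux {M X : Type*} [AddCommGroup M] [Module ℂ M] [AddCommGroup X] [Module ℂ X]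
    (A : Module.End ℂ M) (B : Module.End ℂ X) (T : Module.End ℂ (M ⊗[ℂ] X))
    (hT : ∀ v x, T (v ⊗ₜ[ℂ] x) = A v ⊗ₜ[ℂ] x + v ⊗ₜ[ℂ] B x) (n : ℕ) :
    ∀ (a b : ℕ) (v : M) (x : X), a + b = n → (A ^ a) v = 0 → (B ^ b) x = 0 →
      (T ^ n) (v ⊗ₜ[ℂ] x) = 0 := by
  induction n with
  | zero =>
    intro a b v x hab hv hx
    obtain rfl : a = 0 := by omega
    have hv0 : v = 0 := by simpa using hv
    simp [hv0]
  | succ n ih =>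
    intro a b v x hab hv hx
    rcases a with _ | a
    · have hv0 : v = 0 := by simpa using hv
      simp [hv0]
    rcases b with _ | b
    · have hx0 : x = 0 := by simpa using hx
      simp [hx0]
    rw [pow_succ, Module.End.mul_apply, hT, map_add,
      ih a (b + 1) (A v) x (by omega) (by rwa [pow_succ, Module.End.mul_apply] at hv) hx,
      ih (a + 1) b v (B x) (by omega) hv (by rwa [pow_succ, Module.End.mul_apply] at hx), add_zero]

theorem tensor_locally_nilpotent_aux {M X : Type*} [AddCommGroup M] [Module ℂ M]
    [AddCommGroup X] [Module ℂ X]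
    (A : Module.End ℂ M) (B : Module.End ℂ X) (T : Module.End ℂ (M ⊗[ℂ] X))
    (hT : ∀ v x, T (v ⊗ₜ[ℂ] x) = A v ⊗ₜ[ℂ] x + v ⊗ₜ[ℂ] B x)
    (hA : ∀ v, ∃ k : ℕ, (A ^ k) v = 0) (hB : ∀ x, ∃ k : ℕ, (B ^ k) x = 0)
    (w : M ⊗[ℂ] X) : ∃ k : ℕ, (T ^ k) w = 0 := by
  induction w using TensorProduct.induction_on with
  | zero => exact ⟨0, by simp⟩
  | tmul v x =>
    obtain ⟨a, ha⟩ := hA v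
    obtain ⟨b, hb⟩ := hB x
    exact ⟨a + b, tensor_pow_aux A B T hT _ a b v x rfl ha hb⟩
  | add w₁ w₂ h₁ h₂ =>
    obtain ⟨a, ha⟩ := h₁
    obtain ⟨b, hb⟩ := h₂
    refine ⟨a + b, ?_⟩
    have e₁ : (T ^ (a + b)) w₁ = 0 := by
      rw [add_comm, pow_add, Module.End.mul_apply, ha, map_zero]
    have e₂ : (T ^ (a + b)) w₂ = 0 := by
      rw [pow_add, Module.End.mul_apply, hb, map_zero]
    rw [map_add, e₁, e₂, add_zero]

/-- Let `g` be a Lie algebra over `ℂ`, `m` a Lie subalgebra and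
`χ : g → ℂ` a linear form.  If `M` is a `g`-module such that `y − χ(y)` acts
locally nilpotently on `M` for every `y ∈ m` (a Whittaker module), and `X` is a
`g`-module on which every element of `m` acts locally nilpotently, then for every
`y ∈ m` the operator `y − χ(y)` acts locally nilpotently on both tensor product
`g`-modules `M ⊗ X` and `X ⊗ M`.  Hence the category of Whittaker modules is
stable under tensoring on either side by modules on which `m` acts locally
nilpotently, and is a bimodule category over the monoidal category of such
modules. -/
theorem whittaker_stable_under_tensor
    (g : Type*) [LieRing g] [LieAlgebra ℂ g] (m : LieSubalgebra ℂ g) (χ : g →ₗ[ℂ] ℂ)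
    (M X : Type*) [AddCommGroup M] [Module ℂ M] [LieRingModule g M] [LieModule ℂ g M]
    [AddCommGroup X] [Module ℂ X] [LieRingModule g X] [LieModule ℂ g X]
    (hM : ∀ y ∈ m, ∀ v : M,
      ∃ k : ℕ, ((LieModule.toEnd ℂ g M y - χ y • 1) ^ k) v = 0)
    (hX : ∀ y ∈ m, ∀ x : X, ∃ k : ℕ, ((LieModule.toEnd ℂ g X y) ^ k) x = 0) :
    (∀ y ∈ m, ∀ w : M ⊗[ℂ] X,
        ∃ k : ℕ, ((LieModule.toEnd ℂ g (M ⊗[ℂ] X) y - χ y • 1) ^ k) w = 0)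
    ∧ (∀ y ∈ m, ∀ w : X ⊗[ℂ] M,
        ∃ k : ℕ, ((LieModule.toEnd ℂ g (X ⊗[ℂ] M) y - χ y • 1) ^ k) w = 0) := by
  constructor
  · intro y hy w
    refine tensor_locally_nilpotent_aux _ _ _ (fun v x => ?_) (hM y hy) (hX y hy) w
    simp only [LinearMap.sub_apply, LieModule.toEnd_apply_apply, LinearMap.smul_apply,
      Module.End.one_apply, TensorProduct.LieModule.lie_tmul_right, TensorProduct.sub_tmul,
      TensorProduct.smul_tmul']
    abel
  · intro y hy w
    refine tensor_locally_nilpotent_aux _ _ _ (fun x v => ?_) (hX y hy) (hM y hy) w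
    simp only [LinearMap.sub_apply, LieModule.toEnd_apply_apply, LinearMap.smul_apply,
      Module.End.one_apply, TensorProduct.LieModule.lie_tmul_right, TensorProduct.tmul_sub,
      TensorProduct.tmul_smul]
    abel
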